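/- Let p be a real number with p < 0 or p > 1 and q, r ∈ (1,∞). Then (K_{p,q,r*}(k) − E_{p,q,r*}(k)) · K_{p,r,q*}((1−k^q)^{1/r}) tends to 0 as k → 0 from the right. -/

import Mathlib

open Real MeasureTheory Set Filter

/-- The Euler Beta function. -/
noncomputable def Beta (x y : ℝ) : ℝ := Real.Gamma x * Real.Gamma y / Real.Gamma (x + y)

/-- The generalized complete elliptic integral of the first kind. -/
noncomputable def genK (p q r k : ℝ) : ℝ :=
  ∫ t in (0:ℝ)..1, (1 - t ^ q) ^ (-(1 / p)) * (1 - k ^ q * t ^ q) ^ (-(1 / r))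

/-- The generalized complete elliptic integral of the second kind.
Here `1 - 1/r` is `1/r*` for the Hölder conjugate `r*` of `r`. -/
noncomputable def genE (p q r k : ℝ) : ℝ :=
  ∫ t in (0:ℝ)..1, (1 - k ^ q * t ^ q) ^ (1 - 1 / r) * (1 - t ^ q) ^ (-(1 / p))

lemma aux_int (q b : ℝ) (hq : 1 < q) (hb : -1 < b) :
    IntervalIntegrable (fun t : ℝ => (1 - t ^ q) ^ b) volume 0 1 := by
  have h1 : IntervalIntegrable (fun t : ℝ => t ^ b) volume 0 1 :=
    intervalIntegral.intervalIntegrable_rpow' hb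
  have h2 : IntervalIntegrable (fun t : ℝ => (1 - t) ^ b) volume 0 1 := by
    have := (h1.comp_sub_left 1).symm
    simpa using this
  have h3 : IntervalIntegrable (fun t : ℝ => 1 + (1 - t) ^ b) volume 0 1 :=
    intervalIntegrable_const.add h2
  refine h3.mono_fun' (Measurable.aestronglyMeasurable (by fun_prop)) ?_
  rw [uIoc_of_le zero_le_one, ← restrict_Ioo_eq_restrict_Ioc]
  refine (ae_restrict_iff' measurableSet_Ioo).2 (Eventually.of_forall ?_)
  intro t ht
  have hlt : 0 < 1 - t := by linarith [ht.2]
  have hle : t ^ q ≤ t := by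
    simpa using Real.rpow_le_rpow_of_exponent_ge ht.1 ht.2.le hq.le
  have h0 : 0 ≤ t ^ q := Real.rpow_nonneg ht.1.le _
  have hpos : 0 ≤ (1 - t) ^ b := Real.rpow_nonneg hlt.le _
  have hy : 0 < 1 - t ^ q := by linarith
  show ‖(1 - t ^ q) ^ b‖ ≤ 1 + (1 - t) ^ b
  rw [Real.norm_of_nonneg (Real.rpow_nonneg hy.le _)]
  rcases le_total 0 b with h | h
  · have := Real.rpow_le_one hy.le (by linarith) h
    linarith
  · have := Real.rpow_le_rpow_of_nonpos hlt (by linarith : 1 - t ≤ 1 - t ^ q) h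
    linarith

lemma aux_diff (p q rs k : ℝ) (hb : -1 < -(1 / p)) (hq : 1 < q) (hc : 0 < 1 / rs)
    (hk : 0 < k) (hk2 : k ^ q ≤ 1 / 2) :
    ‖genK p q rs k - genE p q rs k‖ ≤
      k ^ q * ((1 / 2 : ℝ) ^ (-(1 / rs)) * ∫ t in (0:ℝ)..1, (1 - t ^ q) ^ (-(1 / p))) := by
  have hX := aux_int q _ hq hb
  have hkq : 0 ≤ k ^ q := Real.rpow_nonneg hk.le _
  have hy : ∀ t ∈ Icc (0:ℝ) 1, 0 ≤ t ^ q ∧ t ^ q ≤ 1 ∧ 1 / 2 ≤ 1 - k ^ q * t ^ q := by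
    intro t ht
    have h0 : 0 ≤ t ^ q := Real.rpow_nonneg ht.1 _
    have h1 : t ^ q ≤ 1 := Real.rpow_le_one ht.1 ht.2 (by linarith)
    exact ⟨h0, h1, by nlinarith⟩
  have hcont : ∀ s : ℝ, ContinuousOn (fun t : ℝ => (1 - k ^ q * t ^ q) ^ s) (uIcc 0 1) := by
    intro s
    rw [uIcc_of_le zero_le_one]
    refine ContinuousOn.rpow_const ?_ ?_
    · exact (continuous_const.sub (continuous_const.mul
        (Real.continuous_rpow_const (by linarith)))).continuousOn
    · intro t ht
      left
      have := (hy t ht).2.2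
      intro h
      linarith
  unfold genK genE
  rw [← intervalIntegral.integral_sub (hX.mul_continuousOn (hcont _))
    (hX.continuousOn_mul (hcont _)), ← intervalIntegral.integral_const_mul,
    ← intervalIntegral.integral_const_mul]
  refine intervalIntegral.norm_integral_le_of_norm_le zero_le_one ?_
    ((hX.const_mul _).const_mul _)
  refine Eventually.of_forall ?_
  intro t ht
  obtain ⟨h0, h1, h2⟩ := hy t ⟨ht.1.le, ht.2⟩
  have hXn : 0 ≤ (1 - t ^ q) ^ (-(1 / p)) := Real.rpow_nonneg (by linarith) _
  have hyp : 0 < 1 - k ^ q * t ^ q := by linarith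
  have hZ : 0 ≤ (1 - k ^ q * t ^ q) ^ (-(1 / rs)) := Real.rpow_nonneg hyp.le _
  have hZ2 : (1 - k ^ q * t ^ q) ^ (-(1 / rs)) ≤ (1 / 2 : ℝ) ^ (-(1 / rs)) :=
    Real.rpow_le_rpow_of_nonpos (by norm_num) h2 (by linarith)
  have e : (1 - k ^ q * t ^ q) ^ (1 - 1 / rs)
      = (1 - k ^ q * t ^ q) * (1 - k ^ q * t ^ q) ^ (-(1 / rs)) := by
    rw [sub_eq_add_neg 1 (1 / rs), Real.rpow_add hyp, Real.rpow_one]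
  rw [e]
  generalize (1 - k ^ q * t ^ q) ^ (-(1 / rs)) = Z at *
  generalize (1 - t ^ q) ^ (-(1 / p)) = X at *
  have e2 : X * Z - (1 - k ^ q * t ^ q) * Z * X = (k ^ q * t ^ q) * (Z * X) := by ring
  rw [e2, Real.norm_of_nonneg (by positivity)]
  have : k ^ q * t ^ q ≤ k ^ q := by nlinarith
  gcongr

lemma aux_K (p q r qs k : ℝ) (hb : -1 < -(1 / p)) (hr : 1 < r) (hc : 0 < 1 / qs)
    (hk : 0 < k) (hk2 : k ^ q ≤ 1 / 2) :
    ‖genK p r qs ((1 - k ^ q) ^ (1 / r))‖ ≤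
      (k ^ q) ^ (-(1 / qs)) * ∫ t in (0:ℝ)..1, (1 - t ^ r) ^ (-(1 / p)) := by
  have hX := aux_int r _ hr hb
  have hkq : 0 < k ^ q := Real.rpow_pos_of_pos hk _
  unfold genK
  rw [← intervalIntegral.integral_const_mul]
  have e : ((1 - k ^ q) ^ (1 / r)) ^ r = 1 - k ^ q := by
    rw [← Real.rpow_mul (by linarith), one_div_mul_cancel (by linarith), Real.rpow_one]
  rw [e]
  refine intervalIntegral.norm_integral_le_of_norm_le zero_le_one ?_ (hX.const_mul _)
  refine Eventually.of_forall ?_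
  intro t ht
  have h0 : 0 ≤ t ^ r := Real.rpow_nonneg ht.1.le _
  have h1 : t ^ r ≤ 1 := Real.rpow_le_one ht.1.le ht.2 (by linarith)
  have hXn : 0 ≤ (1 - t ^ r) ^ (-(1 / p)) := Real.rpow_nonneg (by linarith) _
  have h2 : k ^ q ≤ 1 - (1 - k ^ q) * t ^ r := by nlinarith
  have hZ : 0 ≤ (1 - (1 - k ^ q) * t ^ r) ^ (-(1 / qs)) := Real.rpow_nonneg (by linarith) _
  have hZ2 := Real.rpow_le_rpow_of_nonpos hkq h2 (by linarith : -(1 / qs) ≤ 0)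
  rw [Real.norm_of_nonneg (by positivity), mul_comm]
  gcongr

theorem genK_sub_genE_mul_genK_tendsto_zero
    (p q r : ℝ) (hp : p < 0 ∨ 1 < p) (hq : 1 < q) (hr : 1 < r)
    (qs rs : ℝ) (hqs : 1 / q + 1 / qs = 1) (hrs : 1 / r + 1 / rs = 1) :
    Tendsto (fun k : ℝ =>
        (genK p q rs k - genE p q rs k) * genK p r qs ((1 - k ^ q) ^ (1 / r)))
      (nhdsWithin 0 (Ioi (0:ℝ))) (nhds 0) := by
  have hb : -1 < -(1 / p) := by
    rcases hp with h | h
    · have : 1 / p < 0 := one_div_neg.2 h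
      linarith
    · have : 1 / p < 1 := by rw [div_lt_one (by linarith)]; exact h
      linarith
  have hq1 : 1 / q < 1 := by rw [div_lt_one (by linarith)]; exact hq
  have hr1 : 1 / r < 1 := by rw [div_lt_one (by linarith)]; exact hr
  set A := (1 / 2 : ℝ) ^ (-(1 / rs)) * ∫ t in (0:ℝ)..1, (1 - t ^ q) ^ (-(1 / p)) with hA
  set B := ∫ t in (0:ℝ)..1, (1 - t ^ r) ^ (-(1 / p)) with hB
  have ht0 : Tendsto (fun k : ℝ => k * (A * B)) (nhdsWithin 0 (Ioi (0:ℝ))) (nhds 0) := by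
    have : Tendsto (fun k : ℝ => k * (A * B)) (nhds 0) (nhds (0 * (A * B))) :=
      (continuous_id.mul continuous_const).tendsto 0
    rw [zero_mul] at this
    exact this.mono_left nhdsWithin_le_nhds
  have hsmall : ∀ᶠ k : ℝ in nhdsWithin 0 (Ioi (0:ℝ)), k ^ q ≤ 1 / 2 := by
    have : Tendsto (fun k : ℝ => k ^ q) (nhds 0) (nhds ((0:ℝ) ^ q)) :=
      (Real.continuous_rpow_const (by linarith)).tendsto 0
    rw [Real.zero_rpow (by linarith)] at this
    exact (this.mono_left nhdsWithin_le_nhds).eventually_le_const (by norm_num)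
  refine squeeze_zero_norm' ?_ ht0
  filter_upwards [hsmall, self_mem_nhdsWithin] with k hk2 hk
  have hk : 0 < k := hk
  have d := aux_diff p q rs k hb hq (by linarith) hk hk2
  have e := aux_K p q r qs k hb hr (by linarith) hk hk2
  rw [norm_mul]
  refine (mul_le_mul d e (norm_nonneg _) ((norm_nonneg _).trans d)).trans (le_of_eq ?_)
  have key : k ^ q * (k ^ q) ^ (-(1 / qs)) = k := by
    rw [← Real.rpow_mul hk.le, ← Real.rpow_add hk]
    have : q + q * -(1 / qs) = 1 := by
      have h : 1 / qs = 1 - 1 / q := by linarith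
      rw [h]
      have : q ≠ 0 := by linarith
      field_simp
      ring
    rw [this, Real.rpow_one]
  calc _ = (k ^ q * (k ^ q) ^ (-(1 / qs))) * (A * B) := by rw [hA, hB]; ring
    _ = _ := by rw [key]
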